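/- arXiv:2303.05814 — 7 statements merged into one kernel-verified Lean document; each statement's English description precedes it below -/
import Mathlib

section
/- Let δ ≥ 0, let x = (x₁,x₂) ∈ ℝ² with x₁² + x₂² = 1, and let λ ∈ ℝ with λ > δ; set E := √(λ² − δ²). Then there exists a continuously differentiable function f : [−1,1] → ℂ², not identically zero, satisfying the infinite mass boundary conditions for the direction x and the equation −i(σ·x)f′(t) + δσ₃f(t) = λf(t) for all t ∈ [−1,1], if and only if δ·sin(2E) + E·cos(2E) = 0. -/
noncomputable section

open Real Set

/-- `σ·x` acting on `ℂ²`, where `σ₁, σ₂` are the first two Pauli matrices. -/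
def sdot (x₁ x₂ : ℝ) (u : ℂ × ℂ) : ℂ × ℂ :=
  (((x₁ : ℂ) - Complex.I * (x₂ : ℂ)) * u.2, ((x₁ : ℂ) + Complex.I * (x₂ : ℂ)) * u.1)

/-- The third Pauli matrix `σ₃` acting on `ℂ²`. -/
def s3 (u : ℂ × ℂ) : ℂ × ℂ := (u.1, -u.2)

/-- Infinite mass boundary conditions for the direction `x = (x₁, x₂)`. -/
def bcx (x₁ x₂ : ℝ) (f : ℝ → ℂ × ℂ) : Prop :=
  (f 1).2 = Complex.I * ((x₁ : ℂ) + Complex.I * (x₂ : ℂ)) * (f 1).1 ∧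
  (f (-1)).2 = -(Complex.I * ((x₁ : ℂ) + Complex.I * (x₂ : ℂ)) * (f (-1)).1)

/-- First integrals of the linear system with derivatives `-p h` of `a` and `q a` of `h`, where `E² = p q`. -/
theorem first_integrals_eq {a h : ℝ → ℂ} {p q E : ℝ} (hE : E ^ 2 = p * q)
    (ha : ∀ t ∈ Icc (-1 : ℝ) 1, HasDerivWithinAt a (-(p * h t)) (Icc (-1 : ℝ) 1) t)
    (hh : ∀ t ∈ Icc (-1 : ℝ) 1, HasDerivWithinAt h (q * a t) (Icc (-1 : ℝ) 1) t)
    {t : ℝ} (ht : t ∈ Icc (-1 : ℝ) 1) :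
    E * a t * Real.cos (E * (t + 1)) + p * h t * Real.sin (E * (t + 1)) = E * a (-1) ∧
    E * h t * Real.cos (E * (t + 1)) - q * a t * Real.sin (E * (t + 1)) = E * h (-1) := by
  have hEc : (E : ℂ) ^ 2 = p * q := by exact_mod_cast hE
  have hlin (t : ℝ) : HasDerivAt (fun t : ℝ => E * (t + 1)) E t := by
    simpa using ((hasDerivAt_id t).add_const 1).const_mul E
  have hc (t : ℝ) := ((hlin t).cos.ofReal_comp).hasDerivWithinAt (s := Icc (-1 : ℝ) 1)
  have hs (t : ℝ) := ((hlin t).sin.ofReal_comp).hasDerivWithinAt (s := Icc (-1 : ℝ) 1)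
  have hconst {F : ℝ → ℂ}
      (hF : ∀ t ∈ Icc (-1 : ℝ) 1, HasDerivWithinAt F 0 (Icc (-1 : ℝ) 1) t) : F t = F (-1) := by
    have := (convex_Icc (-1 : ℝ) 1).norm_image_sub_le_of_norm_hasDerivWithin_le (C := 0) hF
      (by simp) (left_mem_Icc.2 (by norm_num)) ht
    rw [zero_mul] at this
    exact sub_eq_zero.1 (norm_le_zero_iff.1 this)
  constructor
  · have := hconst (F := fun t => E * a t * Real.cos (E * (t + 1)) +
        p * h t * Real.sin (E * (t + 1))) fun t ht => by
      refine ((((ha t ht).const_mul (E : ℂ)).mul (hc t)).add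
        (((hh t ht).const_mul (p : ℂ)).mul (hs t))).congr_deriv ?_
      push_cast
      linear_combination -(a t * Complex.sin (E * (t + 1))) * hEc
    simpa using this
  · have := hconst (F := fun t => E * h t * Real.cos (E * (t + 1)) -
        q * a t * Real.sin (E * (t + 1))) fun t ht => by
      refine ((((hh t ht).const_mul (E : ℂ)).mul (hc t)).sub
        (((ha t ht).const_mul (q : ℂ)).mul (hs t))).congr_deriv ?_
      push_cast
      linear_combination -(h t * Complex.sin (E * (t + 1))) * hEc
    simpa using this

theorem sub_I_mul_mul_add_I_mul_eq_one {x₁ x₂ : ℝ} (hx : x₁ ^ 2 + x₂ ^ 2 = 1) :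
    ((x₁ : ℂ) - Complex.I * x₂) * (x₁ + Complex.I * x₂) = 1 := by
  have : (x₁ : ℂ) ^ 2 + (x₂ : ℂ) ^ 2 = 1 := by exact_mod_cast hx
  linear_combination this - (x₂ : ℂ) ^ 2 * Complex.I_sq

/-- The first-order equation in components, solved for the derivative. -/
theorem dirac_eq_iff {x₁ x₂ : ℝ} (hx : x₁ ^ 2 + x₂ ^ 2 = 1) (δ lam : ℝ) (u v : ℂ × ℂ) :
    (-Complex.I) • sdot x₁ x₂ v + (δ : ℂ) • s3 u = (lam : ℂ) • u ↔
    v.1 = Complex.I * (x₁ - Complex.I * x₂) * (lam + δ) * u.2 ∧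
    v.2 = Complex.I * (x₁ + Complex.I * x₂) * (lam - δ) * u.1 := by
  have hxc := sub_I_mul_mul_add_I_mul_eq_one hx
  simp only [sdot, s3, Prod.ext_iff, Prod.fst_add, Prod.snd_add, Prod.smul_fst, Prod.smul_snd,
    smul_eq_mul]
  generalize (x₁ : ℂ) - Complex.I * x₂ = z at *
  generalize (x₁ : ℂ) + Complex.I * x₂ = w at *
  have hI := Complex.I_sq
  refine ⟨fun ⟨h₁, h₂⟩ => ⟨?_, ?_⟩, fun ⟨h₁, h₂⟩ => ⟨?_, ?_⟩⟩
  · linear_combination Complex.I * z * h₂ + v.1 * (z * w * hI - hxc)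
  · linear_combination Complex.I * w * h₁ + v.2 * (z * w * hI - hxc)
  · linear_combination -Complex.I * z * h₂ - (lam - δ) * u.1 * (z * w * hI - hxc)
  · linear_combination -Complex.I * w * h₁ - (lam + δ) * u.2 * (z * w * hI - hxc)

theorem exists_eigenfunction_iff_implicit_equation
    (δ : ℝ) (hδ : 0 ≤ δ) (x₁ x₂ : ℝ) (hx : x₁ ^ 2 + x₂ ^ 2 = 1)
    (lam : ℝ) (hlam : δ < lam) (E : ℝ) (hE : E = Real.sqrt (lam ^ 2 - δ ^ 2)) :
    (∃ f f' : ℝ → ℂ × ℂ,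
      (∀ t ∈ Set.Icc (-1 : ℝ) 1, HasDerivWithinAt f (f' t) (Set.Icc (-1 : ℝ) 1) t) ∧
      ContinuousOn f' (Set.Icc (-1 : ℝ) 1) ∧
      (∃ t ∈ Set.Icc (-1 : ℝ) 1, f t ≠ 0) ∧
      bcx x₁ x₂ f ∧
      (∀ t ∈ Set.Icc (-1 : ℝ) 1,
        (-Complex.I) • sdot x₁ x₂ (f' t) + (δ : ℂ) • s3 (f t) = (lam : ℂ) • f t)) ↔
    δ * Real.sin (2 * E) + E * Real.cos (2 * E) = 0 := by
  have hpq : 0 < lam ^ 2 - δ ^ 2 := by nlinarith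
  have hE0 : 0 < E := hE ▸ Real.sqrt_pos.2 hpq
  have hE2 : E ^ 2 = (lam + δ) * (lam - δ) := by
    rw [hE, Real.sq_sqrt hpq.le]; ring
  have hEc0 : (E : ℂ) ≠ 0 := by exact_mod_cast hE0.ne'
  have hEc2 : (E : ℂ) ^ 2 = (lam + δ) * (lam - δ) := by exact_mod_cast hE2
  have hI := Complex.I_sq
  have hxc := sub_I_mul_mul_add_I_mul_eq_one hx
  have h2E : E * ((1 : ℝ) + 1) = 2 * E := by ring
  simp only [dirac_eq_iff hx, bcx]
  generalize (x₁ : ℂ) - Complex.I * x₂ = z at *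
  generalize (x₁ : ℂ) + Complex.I * x₂ = w at *
  constructor
  · rintro ⟨f, f', hf, -, ⟨t, ht, hft⟩, ⟨hb₁, hb₂⟩, heq⟩
    have hf₁ (t : ℝ) (ht : t ∈ Icc (-1 : ℝ) 1) :
        HasDerivWithinAt (fun t => (f t).1) (f' t).1 (Icc (-1 : ℝ) 1) t := by
      simpa using (hf t ht).hasFDerivWithinAt.fst.hasDerivWithinAt
    have hf₂ (t : ℝ) (ht : t ∈ Icc (-1 : ℝ) 1) :
        HasDerivWithinAt (fun t => (f t).2) (f' t).2 (Icc (-1 : ℝ) 1) t := by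
      simpa using (hf t ht).hasFDerivWithinAt.snd.hasDerivWithinAt
    have key {t : ℝ} (ht : t ∈ Icc (-1 : ℝ) 1) :=
      first_integrals_eq (a := fun t => (f t).1) (h := fun t => -Complex.I * z * (f t).2) hE2
        (fun t ht => (hf₁ t ht).congr_deriv (by
          rw [(heq t ht).1]; push_cast; ring))
        (fun t ht => ((hf₂ t ht).const_mul (-Complex.I * z)).congr_deriv (by
          rw [(heq t ht).2]; push_cast
          linear_combination (lam - δ) * (f t).1 * (hxc - z * w * hI))) ht
    have hm : -Complex.I * z * (f (-1)).2 = -(f (-1)).1 := by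
      rw [hb₂]; linear_combination (f (-1)).1 * (z * w * hI - hxc)
    have hp : -Complex.I * z * (f 1).2 = (f 1).1 := by
      rw [hb₁]; linear_combination (f 1).1 * (hxc - z * w * hI)
    have hA : (f (-1)).1 ≠ 0 := by
      intro hA
      obtain ⟨k₁, k₂⟩ := key ht
      simp only [hm, hA, neg_zero, mul_zero] at k₁ k₂
      have hcs : (Real.cos (E * (t + 1)) : ℂ) ^ 2 + (Real.sin (E * (t + 1)) : ℂ) ^ 2 = 1 := by
        exact_mod_cast Real.cos_sq_add_sin_sq _
      generalize (Real.cos (E * (t + 1)) : ℂ) = c at *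
      generalize (Real.sin (E * (t + 1)) : ℂ) = s at *
      push_cast at k₁ k₂
      have e₁ : (E : ℂ) ^ 2 * (f t).1 = 0 := by
        linear_combination E * c * k₁ - (lam + δ) * s * k₂ - E ^ 2 * (f t).1 * hcs
          + (f t).1 * s ^ 2 * hEc2
      have e₂ : (E : ℂ) ^ 2 * (-Complex.I * z * (f t).2) = 0 := by
        linear_combination E * c * k₂ + (lam - δ) * s * k₁
          - E ^ 2 * (-Complex.I * z * (f t).2) * hcs
          + (-Complex.I * z * (f t).2) * s ^ 2 * hEc2
      have hz : z ≠ 0 := left_ne_zero_of_mul_eq_one hxc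
      simp only [mul_eq_zero, pow_eq_zero_iff, hEc0, hz, neg_eq_zero, Complex.I_ne_zero,
        false_or, ne_eq, OfNat.ofNat_ne_zero, not_false_eq_true] at e₁ e₂
      exact hft (Prod.ext e₁ e₂)
    obtain ⟨k₁, k₂⟩ := key (right_mem_Icc.2 (by norm_num : (-1 : ℝ) ≤ 1))
    simp only [hm, hp, h2E] at k₁ k₂
    have hC : (f 1).1 ≠ 0 := by
      intro hC
      simp only [hC, mul_zero, zero_mul, add_zero] at k₁
      exact mul_ne_zero hEc0 hA k₁.symm
    have : ((δ * Real.sin (2 * E) + E * Real.cos (2 * E) : ℝ) : ℂ) = 0 := by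
      refine (mul_eq_zero.1 ?_).resolve_left hC
      push_cast at k₁ k₂ ⊢
      linear_combination (k₁ + k₂) / 2
    exact_mod_cast this
  · intro h
    have hlin (t : ℝ) : HasDerivAt (fun t : ℝ => E * (t + 1)) E t := by
      simpa using ((hasDerivAt_id t).add_const 1).const_mul E
    let a : ℝ → ℝ := fun t => E * Real.cos (E * (t + 1)) + (lam + δ) * Real.sin (E * (t + 1))
    let b : ℝ → ℝ := fun t => -E * Real.cos (E * (t + 1)) + (lam - δ) * Real.sin (E * (t + 1))
    have ha (t : ℝ) : HasDerivAt a (-((lam + δ) * b t)) t := by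
      refine (((hlin t).cos.const_mul E).add ((hlin t).sin.const_mul (lam + δ))).congr_deriv ?_
      simp only [b]
      linear_combination -Real.sin (E * (t + 1)) * hE2
    have hb (t : ℝ) : HasDerivAt b ((lam - δ) * a t) t := by
      refine (((hlin t).cos.const_mul (-E)).add ((hlin t).sin.const_mul (lam - δ))).congr_deriv ?_
      simp only [a]
      linear_combination Real.sin (E * (t + 1)) * hE2
    have hac : Continuous a := continuous_iff_continuousAt.2 fun t => (ha t).continuousAt
    have hbc : Continuous b := continuous_iff_continuousAt.2 fun t => (hb t).continuousAt
    have ham : a (-1) = E := by simp [a]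
    have hbm : b (-1) = -E := by simp [b]
    have hab : b 1 = a 1 := by
      simp only [a, b, h2E]
      linear_combination -2 * h
    refine ⟨fun t => (a t, Complex.I * w * b t),
      fun t => ((-((lam + δ) * b t) : ℝ), Complex.I * w * ((lam - δ) * a t : ℝ)),
      fun t _ => ((ha t).ofReal_comp.prodMk
        ((hb t).ofReal_comp.const_mul (Complex.I * w))).hasDerivWithinAt,
      by fun_prop, ⟨-1, left_mem_Icc.2 (by norm_num), ?_⟩, ⟨?_, ?_⟩, fun t _ => ⟨?_, ?_⟩⟩
    · simp [ham, hE0.ne']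
    · simp [hab]
    · simp [ham, hbm]
    · push_cast
      linear_combination (lam + δ) * b t * (hxc - z * w * hI)
    · push_cast
      ring
end
end

section
/- Let δ ≥ 0, let x = (x₁,x₂) ∈ ℝ² with x₁² + x₂² = 1, set n := x₁ + ix₂, and let λ ∈ ℝ with λ > δ and E := √(λ² − δ²). Assume δ·sin(2E) + E·cos(2E) = 0. Then the function u : [−1,1] → ℂ² defined by u(t) := cos(E(t+1))·(1, −i n) + sin(E(t+1))·((λ+δ)/E, i n E/(λ+δ)) is not identically zero, satisfies the infinite mass boundary conditions for the direction x, and satisfies −i(σ·x)u′(t) + δσ₃u(t) = λu(t) for all t ∈ [−1,1]. -/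
noncomputable section

open Real Set

/-- The explicit candidate eigenfunction
`u(t) = cos(E(t+1))·(1, −i n) + sin(E(t+1))·((λ+δ)/E, i n E/(λ+δ))`
with `n = x₁ + i x₂` and `E = √(λ² − δ²)`. -/
def uSol (x₁ x₂ δ lam : ℝ) (t : ℝ) : ℂ × ℂ :=
  ((Real.cos (Real.sqrt (lam ^ 2 - δ ^ 2) * (t + 1)) : ℂ) +
      (Real.sin (Real.sqrt (lam ^ 2 - δ ^ 2) * (t + 1)) : ℂ) *
        (((lam : ℂ) + (δ : ℂ)) / (Real.sqrt (lam ^ 2 - δ ^ 2) : ℂ)),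
   (Real.cos (Real.sqrt (lam ^ 2 - δ ^ 2) * (t + 1)) : ℂ) *
      (-(Complex.I * ((x₁ : ℂ) + Complex.I * (x₂ : ℂ)))) +
    (Real.sin (Real.sqrt (lam ^ 2 - δ ^ 2) * (t + 1)) : ℂ) *
      (Complex.I * ((x₁ : ℂ) + Complex.I * (x₂ : ℂ)) *
        (Real.sqrt (lam ^ 2 - δ ^ 2) : ℂ) / ((lam : ℂ) + (δ : ℂ))))

/-- The explicit derivative of `uSol`. -/
theorem hasDerivAt_uSol (x₁ x₂ δ lam t : ℝ) :
    HasDerivAt (uSol x₁ x₂ δ lam)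
      ((-(Real.sin (Real.sqrt (lam ^ 2 - δ ^ 2) * (t + 1)) * Real.sqrt (lam ^ 2 - δ ^ 2) : ℝ) : ℂ) +
        ((Real.cos (Real.sqrt (lam ^ 2 - δ ^ 2) * (t + 1)) * Real.sqrt (lam ^ 2 - δ ^ 2) : ℝ) : ℂ) *
          (((lam : ℂ) + (δ : ℂ)) / (Real.sqrt (lam ^ 2 - δ ^ 2) : ℂ)),
      (-(Real.sin (Real.sqrt (lam ^ 2 - δ ^ 2) * (t + 1)) * Real.sqrt (lam ^ 2 - δ ^ 2) : ℝ) : ℂ) *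
          (-(Complex.I * ((x₁ : ℂ) + Complex.I * (x₂ : ℂ)))) +
        ((Real.cos (Real.sqrt (lam ^ 2 - δ ^ 2) * (t + 1)) * Real.sqrt (lam ^ 2 - δ ^ 2) : ℝ) : ℂ) *
          (Complex.I * ((x₁ : ℂ) + Complex.I * (x₂ : ℂ)) *
            (Real.sqrt (lam ^ 2 - δ ^ 2) : ℂ) / ((lam : ℂ) + (δ : ℂ)))) t := by
  unfold uSol
  set E := Real.sqrt (lam ^ 2 - δ ^ 2)
  have h : HasDerivAt (fun t : ℝ => E * (t + 1)) E t := by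
    simpa using ((hasDerivAt_id t).add_const 1).const_mul E
  have hc : HasDerivAt (fun t : ℝ => (Real.cos (E * (t + 1)) : ℂ))
      (-(Real.sin (E * (t + 1)) * E : ℝ) : ℂ) t := by
    simpa using h.cos.ofReal_comp
  have hs : HasDerivAt (fun t : ℝ => (Real.sin (E * (t + 1)) : ℂ))
      ((Real.cos (E * (t + 1)) * E : ℝ) : ℂ) t := h.sin.ofReal_comp
  exact (hc.add (hs.mul_const _)).prodMk ((hc.mul_const _).add (hs.mul_const _))

theorem explicit_eigenfunction
    (δ : ℝ) (hδ : 0 ≤ δ) (x₁ x₂ : ℝ) (hx : x₁ ^ 2 + x₂ ^ 2 = 1)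
    (lam : ℝ) (hlam : δ < lam) (E : ℝ) (hE : E = Real.sqrt (lam ^ 2 - δ ^ 2))
    (himp : δ * Real.sin (2 * E) + E * Real.cos (2 * E) = 0) :
    (∃ t ∈ Set.Icc (-1 : ℝ) 1, uSol x₁ x₂ δ lam t ≠ 0) ∧
    bcx x₁ x₂ (uSol x₁ x₂ δ lam) ∧
    Differentiable ℝ (uSol x₁ x₂ δ lam) ∧
    (∀ t ∈ Set.Icc (-1 : ℝ) 1,
      (-Complex.I) • sdot x₁ x₂ (deriv (uSol x₁ x₂ δ lam) t) +
        (δ : ℂ) • s3 (uSol x₁ x₂ δ lam t) = (lam : ℂ) • uSol x₁ x₂ δ lam t) := by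
  have hE2 : E ^ 2 = lam ^ 2 - δ ^ 2 := by
    rw [hE]
    exact Real.sq_sqrt (by nlinarith)
  have hE0 : E ≠ 0 := by
    rintro rfl
    nlinarith
  have hEc : (E : ℂ) ≠ 0 := by exact_mod_cast hE0
  have hs : (lam : ℂ) + δ ≠ 0 := by
    have : lam + δ ≠ 0 := by linarith
    exact_mod_cast this
  have hE2c : (E : ℂ) ^ 2 = (lam : ℂ) ^ 2 - (δ : ℂ) ^ 2 := by exact_mod_cast hE2
  have hxc : (x₁ : ℂ) ^ 2 + (x₂ : ℂ) ^ 2 = 1 := by exact_mod_cast hx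
  have hquot : (E : ℂ) / (lam + δ) = (lam - δ) / E := by
    rw [div_eq_div_iff hs hEc]
    linear_combination hE2c
  refine ⟨⟨-1, by norm_num, fun h => ?_⟩, ⟨?_, ?_⟩,
    fun t => (hasDerivAt_uSol x₁ x₂ δ lam t).differentiableAt, fun t _ => ?_⟩
  · have := congrArg Prod.fst h
    simp [uSol] at this
  · have himpc : (δ : ℂ) * (Real.sin (E * (1 + 1)) : ℂ) + E * (Real.cos (E * (1 + 1)) : ℂ) = 0 := by
      rw [show E * (1 + 1) = 2 * E by ring]
      exact_mod_cast himp
    simp only [uSol, ← hE]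
    rw [mul_div_assoc, hquot]
    field_simp
    linear_combination (-2 * ((x₁ : ℂ) + Complex.I * x₂)) * himpc
  · simp [uSol]
  · rw [(hasDerivAt_uSol x₁ x₂ δ lam t).deriv]
    simp only [uSol, sdot, s3, ← hE]
    generalize Real.sin (E * (t + 1)) = s
    generalize Real.cos (E * (t + 1)) = c
    rw [mul_div_assoc, hquot]
    have hn : Complex.I ^ 2 * ((x₁ : ℂ) - Complex.I * x₂) * (x₁ + Complex.I * x₂) = -1 := by
      linear_combination ((x₁ : ℂ) ^ 2 - (Complex.I ^ 2 - 1) * x₂ ^ 2) * Complex.I_sq - hxc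
    ext1
    · simp only [Prod.fst_add, Prod.smul_fst, smul_eq_mul]
      push_cast
      field_simp
      linear_combination (-(E * (s * E + c * (lam - δ))) : ℂ) * hn + (s : ℂ) * hE2c
    · simp only [Prod.snd_add, Prod.smul_snd, smul_eq_mul]
      push_cast
      field_simp
      linear_combination ((x₁ : ℂ) + Complex.I * x₂) * s * hE2c
end
end

section
/- Let δ ≥ 0, let x = (x₁,x₂) ∈ ℝ² with x₁² + x₂² = 1, and let λ ∈ ℝ with |λ| ≤ δ. If f : [−1,1] → ℂ² is continuously differentiable, satisfies the infinite mass boundary conditions for the direction x, and satisfies −i(σ·x)f′(t) + δσ₃f(t) = λf(t) for all t ∈ [−1,1], then f is identically zero. (In other words, the transverse operator has no eigenvalues in the interval [−δ, δ].) -/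
noncomputable section

open Real Set

/-- A solution of the linear system `a' = -p g`, `g' = -q a` on `[-1, 1]` with
`p, q ≥ 0` vanishes identically when `g 1 = a 1` and `g (-1) = -a (-1)`. -/
theorem eq_zero_of_linear_system {p q : ℝ} (hp : 0 ≤ p) (hq : 0 ≤ q) {a g : ℝ → ℂ}
    (ha : ∀ t ∈ Icc (-1 : ℝ) 1, HasDerivWithinAt a (-(p : ℂ) * g t) (Icc (-1 : ℝ) 1) t)
    (hg : ∀ t ∈ Icc (-1 : ℝ) 1, HasDerivWithinAt g (-(q : ℂ) * a t) (Icc (-1 : ℝ) 1) t)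
    (h_right : g 1 = a 1) (h_left : g (-1) = -a (-1)) :
    ∀ t ∈ Icc (-1 : ℝ) 1, a t = 0 ∧ g t = 0 := by
  have hre {u : ℝ → ℂ} {u' : ℂ} {t : ℝ} (h : HasDerivWithinAt u u' (Icc (-1 : ℝ) 1) t) :
      HasDerivWithinAt (fun s => (u s).re) u'.re (Icc (-1 : ℝ) 1) t :=
    Complex.reCLM.hasFDerivAt.comp_hasDerivWithinAt t h
  have him {u : ℝ → ℂ} {u' : ℂ} {t : ℝ} (h : HasDerivWithinAt u u' (Icc (-1 : ℝ) 1) t) :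
      HasDerivWithinAt (fun s => (u s).im) u'.im (Icc (-1 : ℝ) 1) t :=
    Complex.imCLM.hasFDerivAt.comp_hasDerivWithinAt t h
  have anti {h h' : ℝ → ℝ}
      (hd : ∀ t ∈ Icc (-1 : ℝ) 1, HasDerivWithinAt h (h' t) (Icc (-1 : ℝ) 1) t)
      (hn : ∀ t ∈ Icc (-1 : ℝ) 1, h' t ≤ 0) : AntitoneOn h (Icc (-1 : ℝ) 1) :=
    antitoneOn_of_hasDerivWithinAt_nonpos (convex_Icc _ _)
      (fun t ht => (hd t ht).continuousWithinAt)
      (fun t ht => (hd t (interior_subset ht)).mono interior_subset)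
      (fun t ht => hn t (interior_subset ht))
  have m1 : (1 : ℝ) ∈ Icc (-1 : ℝ) 1 := by simp
  have m2 : (-1 : ℝ) ∈ Icc (-1 : ℝ) 1 := by simp
  have pairing_anti := anti
    (fun t ht => ((hre (ha t ht)).mul (hre (hg t ht))).add ((him (ha t ht)).mul (him (hg t ht))))
    (fun t _ => by
      have h1 := mul_nonneg hp (Complex.normSq_nonneg (g t))
      have h2 := mul_nonneg hq (Complex.normSq_nonneg (a t))
      simp only [Complex.normSq_apply] at h1 h2
      simp
      nlinarith)
  have pairing_zero : ∀ t ∈ Icc (-1 : ℝ) 1,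
      (a t).re * (g t).re + (a t).im * (g t).im = 0 := by
    intro t ht
    have h1 := pairing_anti ht m1 ht.2
    have h2 := pairing_anti m2 ht ht.1
    simp [h_right, h_left] at h1 h2
    nlinarith [mul_self_nonneg (a 1).re, mul_self_nonneg (a 1).im,
      mul_self_nonneg (a (-1)).re, mul_self_nonneg (a (-1)).im]
  have norm_anti := anti
    (fun t ht => (((hre (ha t ht)).pow 2).add ((him (ha t ht)).pow 2)).add
      (((hre (hg t ht)).pow 2).add ((him (hg t ht)).pow 2)))
    (fun t ht => by
      simp
      linear_combination -2 * (p + q) * pairing_zero t ht)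
  intro t ht
  have h0 := pairing_zero _ m2
  have h1 := norm_anti m2 ht ht.1
  simp [h_left] at h0 h1
  have h2 : (a t).re ^ 2 + (a t).im ^ 2 + ((g t).re ^ 2 + (g t).im ^ 2) ≤ 0 := by
    nlinarith
  refine ⟨Complex.ext ?_ ?_, Complex.ext ?_ ?_⟩ <;> simp only [Complex.zero_re, Complex.zero_im] <;>
    refine pow_eq_zero_iff two_ne_zero |>.1 (le_antisymm ?_ (sq_nonneg _)) <;>
    linarith [sq_nonneg (a t).re, sq_nonneg (a t).im, sq_nonneg (g t).re, sq_nonneg (g t).im]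

theorem no_eigenvalues_in_gap
    (δ : ℝ) (hδ : 0 ≤ δ) (x₁ x₂ : ℝ) (hx : x₁ ^ 2 + x₂ ^ 2 = 1)
    (lam : ℝ) (hlam : |lam| ≤ δ)
    (f f' : ℝ → ℂ × ℂ)
    (hdiff : ∀ t ∈ Set.Icc (-1 : ℝ) 1, HasDerivWithinAt f (f' t) (Set.Icc (-1 : ℝ) 1) t)
    (hcont : ContinuousOn f' (Set.Icc (-1 : ℝ) 1))
    (hbc : bcx x₁ x₂ f)
    (heq : ∀ t ∈ Set.Icc (-1 : ℝ) 1,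
      (-Complex.I) • sdot x₁ x₂ (f' t) + (δ : ℂ) • s3 (f t) = (lam : ℂ) • f t) :
    ∀ t ∈ Set.Icc (-1 : ℝ) 1, f t = 0 := by
  obtain ⟨hl, hr⟩ := abs_le.1 hlam
  obtain ⟨hb1, hb2⟩ := hbc
  set z : ℂ := (x₁ : ℂ) + Complex.I * (x₂ : ℂ) with hz
  set w : ℂ := (x₁ : ℂ) - Complex.I * (x₂ : ℂ) with hw
  have hwz : w * z = 1 := by
    have hx' : (x₁ : ℂ) ^ 2 + (x₂ : ℂ) ^ 2 = 1 := by exact_mod_cast hx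
    rw [hz, hw]
    linear_combination hx' - (x₂ : ℂ) ^ 2 * Complex.I_sq
  have key := eq_zero_of_linear_system (p := δ + lam) (q := δ - lam) (by linarith) (by linarith)
    (a := fun t => (f t).1) (g := fun t => -Complex.I * w * (f t).2) ?_ ?_ ?_ ?_
  · intro t ht
    obtain ⟨h1, h2⟩ := key t ht
    refine Prod.ext h1 ?_
    simp only [Prod.snd_zero]
    linear_combination (Complex.I * z) * h2 + (f t).2 * (z * w * Complex.I_sq - hwz)
  · intro t ht
    have h := congrArg Prod.snd (heq t ht)
    simp only [sdot, s3, ← hz, Prod.snd_add, Prod.smul_snd, smul_eq_mul] at h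
    have hd : HasDerivWithinAt (fun s => (f s).1) (f' t).1 (Icc (-1 : ℝ) 1) t :=
      (ContinuousLinearMap.fst ℝ ℂ ℂ).hasFDerivAt.comp_hasDerivWithinAt t (hdiff t ht)
    refine hd.congr_deriv ?_
    push_cast
    linear_combination (Complex.I * w) * h - (f' t).1 * (hwz - w * z * Complex.I_sq)
  · intro t ht
    have h := congrArg Prod.fst (heq t ht)
    simp only [sdot, s3, ← hw, Prod.fst_add, Prod.smul_fst, smul_eq_mul] at h
    have hd : HasDerivWithinAt (fun s => (f s).2) (f' t).2 (Icc (-1 : ℝ) 1) t :=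
      (ContinuousLinearMap.snd ℝ ℂ ℂ).hasFDerivAt.comp_hasDerivWithinAt t (hdiff t ht)
    refine (hd.const_mul (-Complex.I * w)).congr_deriv ?_
    push_cast
    linear_combination h
  · simp only [hb1]
    linear_combination (f 1).1 * (hwz - w * z * Complex.I_sq)
  · simp only [hb2]
    linear_combination (f (-1)).1 * (-hwz + w * z * Complex.I_sq)
end
end

section
/- Let δ, λ ∈ ℝ and let x = (x₁,x₂) ∈ ℝ² with x₁² + x₂² = 1. If f : [−1,1] → ℂ² is continuously differentiable, satisfies the infinite mass boundary conditions for the direction x, and satisfies −i(σ·x)f′(t) + δσ₃f(t) = λf(t) for all t ∈ [−1,1], then the function g : [−1,1] → ℂ² defined by g(t) := σ₁ · conj(f(t)) (i.e. g₁ = conj(f₂), g₂ = conj(f₁)) also satisfies the infinite mass boundary conditions for the direction x and satisfies −i(σ·x)g′(t) + δσ₃g(t) = −λg(t) for all t ∈ [−1,1]. (The spectrum of the transverse operator is symmetric with respect to zero.) -/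
noncomputable section

open Real Set

/-- Charge conjugation `u ↦ σ₁ · conj u` on `ℂ²`. -/
def chargeConj (u : ℂ × ℂ) : ℂ × ℂ := ((starRingEnd ℂ) u.2, (starRingEnd ℂ) u.1)

theorem hasDerivWithinAt_chargeConj {f : ℝ → ℂ × ℂ} {f' : ℂ × ℂ} {s : Set ℝ} {t : ℝ}
    (hf : HasDerivWithinAt f f' s t) :
    HasDerivWithinAt (fun τ => chargeConj (f τ)) (chargeConj f') s t :=
  (((Complex.conjCLE : ℂ →L[ℝ] ℂ).comp (ContinuousLinearMap.snd ℝ ℂ ℂ)).prod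
    ((Complex.conjCLE : ℂ →L[ℝ] ℂ).comp
      (ContinuousLinearMap.fst ℝ ℂ ℂ))).hasFDerivAt.comp_hasDerivWithinAt t hf

theorem charge_conjugation_transverse
    (δ lam : ℝ) (x₁ x₂ : ℝ) (hx : x₁ ^ 2 + x₂ ^ 2 = 1)
    (f f' : ℝ → ℂ × ℂ)
    (hdiff : ∀ t ∈ Set.Icc (-1 : ℝ) 1, HasDerivWithinAt f (f' t) (Set.Icc (-1 : ℝ) 1) t)
    (hcont : ContinuousOn f' (Set.Icc (-1 : ℝ) 1))
    (hbc : bcx x₁ x₂ f)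
    (heq : ∀ t ∈ Set.Icc (-1 : ℝ) 1,
      (-Complex.I) • sdot x₁ x₂ (f' t) + (δ : ℂ) • s3 (f t) = (lam : ℂ) • f t) :
    (∀ t ∈ Set.Icc (-1 : ℝ) 1,
      HasDerivWithinAt (fun τ => chargeConj (f τ)) (chargeConj (f' t)) (Set.Icc (-1 : ℝ) 1) t) ∧
    bcx x₁ x₂ (fun τ => chargeConj (f τ)) ∧
    (∀ t ∈ Set.Icc (-1 : ℝ) 1,
      (-Complex.I) • sdot x₁ x₂ (chargeConj (f' t)) + (δ : ℂ) • s3 (chargeConj (f t)) =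
        (-(lam : ℂ)) • chargeConj (f t)) := by
  have hx' : (x₁ : ℂ) ^ 2 + (x₂ : ℂ) ^ 2 = 1 := by exact_mod_cast hx
  refine ⟨fun t ht => hasDerivWithinAt_chargeConj (hdiff t ht), ?_, fun t ht => ?_⟩
  · obtain ⟨h₁, h₂⟩ := hbc
    constructor
    · simp only [chargeConj, h₁, map_mul, map_add, Complex.conj_I, Complex.conj_ofReal]
      linear_combination (-(starRingEnd ℂ) (f 1).1) * hx' +
        (starRingEnd ℂ) (f 1).1 *
          ((x₁ : ℂ) ^ 2 + (x₂ : ℂ) ^ 2 - Complex.I ^ 2 * (x₂ : ℂ) ^ 2) * Complex.I_sq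
    · simp only [chargeConj, h₂, map_neg, map_mul, map_add, Complex.conj_I, Complex.conj_ofReal]
      linear_combination (-(starRingEnd ℂ) (f (-1)).1) * hx' +
        (starRingEnd ℂ) (f (-1)).1 *
          ((x₁ : ℂ) ^ 2 + (x₂ : ℂ) ^ 2 - Complex.I ^ 2 * (x₂ : ℂ) ^ 2) * Complex.I_sq
  · have h := heq t ht
    have h₁ := congrArg (fun u => (starRingEnd ℂ) u.1) h
    have h₂ := congrArg (fun u => (starRingEnd ℂ) u.2) h
    simp only [sdot, s3, Prod.fst_add, Prod.snd_add, Prod.smul_fst, Prod.smul_snd, smul_eq_mul,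
      map_add, map_sub, map_mul, map_neg, Complex.conj_I, Complex.conj_ofReal] at h₁ h₂
    ext1 <;> simp only [chargeConj, sdot, s3, Prod.fst_add, Prod.snd_add, Prod.smul_fst,
      Prod.smul_snd, smul_eq_mul]
    · linear_combination -h₂
    · linear_combination -h₁
end
end

section
/- Let x = (x₁,x₂) ∈ ℝ² with x₁² + x₂² = 1. For every continuously differentiable f : [−1,1] → ℂ² satisfying the infinite mass boundary conditions for the direction x, there holds 2·Re ∫₋₁¹ ⟨−i(σ·x)f′(t), σ₃f(t)⟩ dt = ‖f(1)‖² + ‖f(−1)‖², where ⟨u,v⟩ := u₁·conj(v₁) + u₂·conj(v₂). -/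
noncomputable section

open Real Set

/-- Squared Euclidean (Hermitian) norm on `ℂ²`. -/
def normSq2 (u : ℂ × ℂ) : ℝ := Complex.normSq u.1 + Complex.normSq u.2

/-- Hermitian inner product on `ℂ²`, linear in the first entry. -/
def inner2 (u v : ℂ × ℂ) : ℂ := u.1 * (starRingEnd ℂ) v.1 + u.2 * (starRingEnd ℂ) v.2

/-- The real part of `⟨-i(σ·x)f', σ₃f⟩` is the derivative of `Re (-i (x₁ - i x₂) f₂ conj(f₁))`. -/
theorem hasDerivAt_boundary_form (x₁ x₂ : ℝ) {f : ℝ → ℂ × ℂ} {v : ℂ × ℂ} {t : ℝ}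
    (hf : HasDerivAt f v t) :
    HasDerivAt (fun s => (-Complex.I * ((x₁ : ℂ) - Complex.I * (x₂ : ℂ)) *
        ((f s).2 * (starRingEnd ℂ) (f s).1)).re)
      (inner2 ((-Complex.I) • sdot x₁ x₂ v) (s3 (f t))).re t := by
  have h₁ : HasDerivAt (fun s => (f s).1) v.1 t := hf.fst
  have h₂ : HasDerivAt (fun s => (f s).2) v.2 t := hf.snd
  have h := (h₂.mul h₁.star).const_mul (-Complex.I * ((x₁ : ℂ) - Complex.I * (x₂ : ℂ)))
  have hre := Complex.reCLM.hasFDerivAt.comp_hasDerivAt t h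
  refine hre.congr_deriv ?_
  simp [inner2, sdot, s3]
  ring

/-- Under the infinite mass boundary conditions the boundary form is half the squared norm,
with opposite signs at the two endpoints. -/
theorem boundary_form_eq {x₁ x₂ : ℝ} (hx : x₁ ^ 2 + x₂ ^ 2 = 1) {u : ℂ × ℂ} {ε : ℝ}
    (hε : ε ^ 2 = 1)
    (hu : u.2 = (ε : ℂ) * (Complex.I * ((x₁ : ℂ) + Complex.I * (x₂ : ℂ)) * u.1)) :
    2 * (-Complex.I * ((x₁ : ℂ) - Complex.I * (x₂ : ℂ)) *
      (u.2 * (starRingEnd ℂ) u.1)).re = ε * normSq2 u := by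
  simp only [normSq2, hu, Complex.normSq_apply]
  simp
  grind

theorem cross_term_boundary_identity
    (x₁ x₂ : ℝ) (hx : x₁ ^ 2 + x₂ ^ 2 = 1)
    (f f' : ℝ → ℂ × ℂ)
    (hdiff : ∀ t ∈ Set.Icc (-1 : ℝ) 1, HasDerivWithinAt f (f' t) (Set.Icc (-1 : ℝ) 1) t)
    (hcont : ContinuousOn f' (Set.Icc (-1 : ℝ) 1))
    (hbc : bcx x₁ x₂ f) :
    2 * (∫ t in (-1 : ℝ)..1, inner2 ((-Complex.I) • sdot x₁ x₂ (f' t)) (s3 (f t))).re =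
      normSq2 (f 1) + normSq2 (f (-1)) := by
  have hfc : ContinuousOn f (Set.Icc (-1 : ℝ) 1) := fun t ht => (hdiff t ht).continuousWithinAt
  have hint : ContinuousOn
      (fun t => inner2 ((-Complex.I) • sdot x₁ x₂ (f' t)) (s3 (f t))) (Set.Icc (-1 : ℝ) 1) := by
    simp only [inner2, sdot, s3, Prod.smul_mk, smul_eq_mul]
    fun_prop
  have hle : (-1 : ℝ) ≤ 1 := by norm_num
  have hintegrable := hint.intervalIntegrable_of_Icc (μ := MeasureTheory.volume) hle
  have hre := Complex.reCLM.intervalIntegral_comp_comm hintegrable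
  simp only [Complex.reCLM_apply] at hre
  have hftc := intervalIntegral.integral_eq_sub_of_hasDerivAt_of_le hle
    (f := fun s => (-Complex.I * ((x₁ : ℂ) - Complex.I * (x₂ : ℂ)) *
        ((f s).2 * (starRingEnd ℂ) (f s).1)).re)
    (by fun_prop)
    (fun t ht => hasDerivAt_boundary_form x₁ x₂
      ((hdiff t (Ioo_subset_Icc_self ht)).hasDerivAt (Icc_mem_nhds ht.1 ht.2)))
    ((Complex.continuous_re.comp_continuousOn hint).intervalIntegrable_of_Icc hle)
  have hright := boundary_form_eq hx (u := f 1) (ε := 1) (by norm_num) (by simpa using hbc.1)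
  have hleft := boundary_form_eq hx (u := f (-1)) (ε := -1) (by norm_num) (by simpa using hbc.2)
  rw [← hre, hftc]
  linarith
end
end

section
/- Let j ≥ 1 be an integer, let x = (x₁,x₂) ∈ ℝ² with x₁² + x₂² = 1, and set n := x₁ + ix₂. Define φ_j⁺ : [−1,1] → ℂ² by φ_j⁺(t) := ½cos((2j−1)π(t+1)/4)·(1, −i n) + ½sin((2j−1)π(t+1)/4)·(1, i n). Then: (a) φ_j⁺ satisfies the infinite mass boundary conditions for the direction x; (b) −i(σ·x)(φ_j⁺)′(t) = ((2j−1)π/4)·φ_j⁺(t) for all t ∈ [−1,1]; (c) ∫₋₁¹ ‖φ_j⁺(t)‖² dt = 1. -/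
noncomputable section

open Real Set

/-- The function `φ_j⁺(t) = ½cos((2j−1)π(t+1)/4)·(1, −i n) + ½sin((2j−1)π(t+1)/4)·(1, i n)`
with `n = x₁ + i x₂`. -/
def phiJ (j : ℕ) (x₁ x₂ : ℝ) (t : ℝ) : ℂ × ℂ :=
  ((Real.cos ((2 * (j : ℝ) - 1) * π * (t + 1) / 4) : ℂ) / 2 +
      (Real.sin ((2 * (j : ℝ) - 1) * π * (t + 1) / 4) : ℂ) / 2,
   (Real.cos ((2 * (j : ℝ) - 1) * π * (t + 1) / 4) : ℂ) / 2 *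
      (-(Complex.I * ((x₁ : ℂ) + Complex.I * (x₂ : ℂ)))) +
    (Real.sin ((2 * (j : ℝ) - 1) * π * (t + 1) / 4) : ℂ) / 2 *
      (Complex.I * ((x₁ : ℂ) + Complex.I * (x₂ : ℂ))))

theorem hasDerivAt_phiJ (j : ℕ) (x₁ x₂ t : ℝ) :
    HasDerivAt (phiJ j x₁ x₂)
      ((((2 * (j : ℝ) - 1) * π / 4 : ℝ) : ℂ) *
          ((Real.cos ((2 * (j : ℝ) - 1) * π * (t + 1) / 4) : ℂ) / 2 -
            (Real.sin ((2 * (j : ℝ) - 1) * π * (t + 1) / 4) : ℂ) / 2),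
        (((2 * (j : ℝ) - 1) * π / 4 : ℝ) : ℂ) *
          (((Real.cos ((2 * (j : ℝ) - 1) * π * (t + 1) / 4) : ℂ) / 2 +
            (Real.sin ((2 * (j : ℝ) - 1) * π * (t + 1) / 4) : ℂ) / 2) *
              (Complex.I * ((x₁ : ℂ) + Complex.I * (x₂ : ℂ))))) t := by
  have hθ : HasDerivAt (fun t : ℝ => (2 * (j : ℝ) - 1) * π * (t + 1) / 4)
      ((2 * (j : ℝ) - 1) * π / 4) t := by
    simpa using (((hasDerivAt_id t).add_const 1).const_mul ((2 * (j : ℝ) - 1) * π)).div_const 4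
  have hc := hθ.cos.ofReal_comp.div_const 2
  have hs := hθ.sin.ofReal_comp.div_const 2
  refine HasDerivAt.prodMk ((hc.add hs).congr_deriv ?_)
    (((hc.mul_const _).add (hs.mul_const _)).congr_deriv ?_) <;> push_cast <;> ring

theorem bcx_phiJ (j : ℕ) (x₁ x₂ : ℝ) : bcx x₁ x₂ (phiJ j x₁ x₂) := by
  have h : Real.cos ((2 * (j : ℝ) - 1) * π * (1 + 1) / 4) = 0 :=
    Real.cos_eq_zero_iff.mpr ⟨(j : ℤ) - 1, by push_cast; ring⟩
  constructor
  · simp only [phiJ, h, Complex.ofReal_zero]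
    ring
  · simp only [phiJ, neg_add_cancel, mul_zero, zero_div, Real.cos_zero, Real.sin_zero,
      Complex.ofReal_zero, Complex.ofReal_one]
    ring

theorem sdot_deriv_phiJ (j : ℕ) {x₁ x₂ : ℝ} (hx : x₁ ^ 2 + x₂ ^ 2 = 1) (t : ℝ) :
    (-Complex.I) • sdot x₁ x₂ (deriv (phiJ j x₁ x₂) t) =
      (((2 * (j : ℝ) - 1) * π / 4 : ℝ) : ℂ) • phiJ j x₁ x₂ t := by
  have hx' : (x₁ : ℂ) ^ 2 + (x₂ : ℂ) ^ 2 = 1 := mod_cast hx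
  rw [(hasDerivAt_phiJ j x₁ x₂ t).deriv]
  simp only [sdot, phiJ, Prod.smul_mk, smul_eq_mul]
  generalize (((2 * (j : ℝ) - 1) * π / 4 : ℝ) : ℂ) = k
  generalize (Real.cos ((2 * (j : ℝ) - 1) * π * (t + 1) / 4) : ℂ) = c
  generalize (Real.sin ((2 * (j : ℝ) - 1) * π * (t + 1) / 4) : ℂ) = s
  refine Prod.ext ?_ ?_
  · linear_combination k * (c / 2 + s / 2) * hx' -
      k * (c / 2 + s / 2) * ((x₁ : ℂ) ^ 2 + (x₂ : ℂ) ^ 2 * (1 - Complex.I ^ 2)) * Complex.I_sq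
  · ring

theorem normSq2_phiJ (j : ℕ) {x₁ x₂ : ℝ} (hx : x₁ ^ 2 + x₂ ^ 2 = 1) (t : ℝ) :
    normSq2 (phiJ j x₁ x₂ t) = 1 / 2 := by
  have hcs := Real.sin_sq_add_cos_sq ((2 * (j : ℝ) - 1) * π * (t + 1) / 4)
  simp only [normSq2, phiJ]
  generalize Real.cos ((2 * (j : ℝ) - 1) * π * (t + 1) / 4) = c at *
  generalize Real.sin ((2 * (j : ℝ) - 1) * π * (t + 1) / 4) = s at *
  have h₁ : (c : ℂ) / 2 + (s : ℂ) / 2 = (((c + s) / 2 : ℝ) : ℂ) := by push_cast; ring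
  have h₂ : (c : ℂ) / 2 * (-(Complex.I * ((x₁ : ℂ) + Complex.I * (x₂ : ℂ)))) +
      (s : ℂ) / 2 * (Complex.I * ((x₁ : ℂ) + Complex.I * (x₂ : ℂ))) =
      (((s - c) / 2 : ℝ) : ℂ) * (Complex.I * ((x₁ : ℂ) + (x₂ : ℂ) * Complex.I)) := by
    push_cast; ring
  rw [h₁, h₂, Complex.normSq_mul, Complex.normSq_mul, Complex.normSq_I,
    Complex.normSq_add_mul_I, hx, Complex.normSq_ofReal, Complex.normSq_ofReal]
  linear_combination hcs / 2

theorem phiJ_eigenfunction (j : ℕ) (hj : 1 ≤ j) (x₁ x₂ : ℝ) (hx : x₁ ^ 2 + x₂ ^ 2 = 1) :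
    bcx x₁ x₂ (phiJ j x₁ x₂) ∧
    Differentiable ℝ (phiJ j x₁ x₂) ∧
    (∀ t ∈ Set.Icc (-1 : ℝ) 1,
      (-Complex.I) • sdot x₁ x₂ (deriv (phiJ j x₁ x₂) t) =
        (((2 * (j : ℝ) - 1) * π / 4 : ℝ) : ℂ) • phiJ j x₁ x₂ t) ∧
    ∫ t in (-1 : ℝ)..1, normSq2 (phiJ j x₁ x₂ t) = 1 := by
  refine ⟨bcx_phiJ j x₁ x₂, fun t => (hasDerivAt_phiJ j x₁ x₂ t).differentiableAt,
    fun t _ => sdot_deriv_phiJ j hx t, ?_⟩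
  simp only [normSq2_phiJ j hx, intervalIntegral.integral_const]
  norm_num
end
end

section
/- Let γ : ℝ → ℝ² be twice continuously differentiable with ‖γ′(s)‖ = 1 for all s, let ν(s) := (−γ₂′(s), γ₁′(s)), κ(s) := ⟨γ″(s), ν(s)⟩, n(s) := ν₁(s) + iν₂(s), φ₁⁺(s,t) := ½cos(π(t+1)/4)·(1, −i n(s)) + ½sin(π(t+1)/4)·(1, i n(s)) and φ₁⁻(s,t) := σ₁·conj(φ₁⁺(s,t)). Then for every s ∈ ℝ: ∫₋₁¹ ⟨φ₁⁺(s,t), ∂_sφ₁⁺(s,t)⟩ dt = (iκ(s)/4)(4/π − 2), ∫₋₁¹ ⟨φ₁⁻(s,t), ∂_sφ₁⁻(s,t)⟩ dt = (iκ(s)/4)(2 − 4/π), ∫₋₁¹ ⟨φ₁⁺(s,t), ∂_sφ₁⁻(s,t)⟩ dt = 0, and ∫₋₁¹ ⟨φ₁⁻(s,t), ∂_sφ₁⁺(s,t)⟩ dt = 0, where ⟨u,v⟩ := u₁·conj(v₁) + u₂·conj(v₂). -/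
noncomputable section

open Real Set

/-- The normal `ν(s) = (−γ₂′(s), γ₁′(s))` of a planar curve `γ`. -/
def nuVec (γ : ℝ → ℝ × ℝ) (s : ℝ) : ℝ × ℝ := (-(deriv γ s).2, (deriv γ s).1)

/-- The curvature `κ(s) = ⟨γ″(s), ν(s)⟩` of a unit-speed planar curve `γ`. -/
def curv (γ : ℝ → ℝ × ℝ) (s : ℝ) : ℝ :=
  (deriv (deriv γ) s).1 * (nuVec γ s).1 + (deriv (deriv γ) s).2 * (nuVec γ s).2

/-- The complex normal `n(s) = ν₁(s) + i ν₂(s)`. -/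
def nC (γ : ℝ → ℝ × ℝ) (s : ℝ) : ℂ :=
  ((nuVec γ s).1 : ℂ) + Complex.I * ((nuVec γ s).2 : ℂ)

/-- `φ₁⁺(t) = ½cos(π(t+1)/4)·(1, −i n) + ½sin(π(t+1)/4)·(1, i n)`. -/
def phi1 (n : ℂ) (t : ℝ) : ℂ × ℂ :=
  ((Real.cos (π * (t + 1) / 4) : ℂ) / 2 + (Real.sin (π * (t + 1) / 4) : ℂ) / 2,
   (Real.cos (π * (t + 1) / 4) : ℂ) / 2 * (-(Complex.I * n)) +
     (Real.sin (π * (t + 1) / 4) : ℂ) / 2 * (Complex.I * n))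

/-- `φ₁⁻ = σ₁ · conj φ₁⁺`. -/
def phi1m (n : ℂ) (t : ℝ) : ℂ × ℂ :=
  ((starRingEnd ℂ) (phi1 n t).2, (starRingEnd ℂ) (phi1 n t).1)

/-- The complex normal satisfies the Frenet equation `n′ = iκn`. -/
theorem hasDerivAt_nC {γ : ℝ → ℝ × ℝ} (hγ : ContDiff ℝ 2 γ)
    (hunit : ∀ s : ℝ, (deriv γ s).1 ^ 2 + (deriv γ s).2 ^ 2 = 1) (s : ℝ) :
    HasDerivAt (nC γ) (Complex.I * (curv γ s : ℂ) * nC γ s) s := by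
  have hdiff : HasDerivAt (deriv γ) (deriv (deriv γ) s) s :=
    (((contDiff_succ_iff_deriv (n := 1)).1 hγ).2.2.differentiable one_ne_zero s).hasDerivAt
  have h1 : HasDerivAt (fun x => (deriv γ x).1) (deriv (deriv γ) s).1 s := hdiff.fst
  have h2 : HasDerivAt (fun x => (deriv γ x).2) (deriv (deriv γ) s).2 s := hdiff.snd
  have horth : 2 * (deriv γ s).1 * (deriv (deriv γ) s).1
      + 2 * (deriv γ s).2 * (deriv (deriv γ) s).2 = 0 := by
    have h := (h1.pow 2).add (h2.pow 2)
    have hc : HasDerivAt ((fun x => (deriv γ x).1) ^ 2 + (fun x => (deriv γ x).2) ^ 2) 0 s := by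
      have : ((fun x => (deriv γ x).1) ^ 2 + (fun x => (deriv γ x).2) ^ 2) = fun _ => (1 : ℝ) :=
        funext hunit
      rw [this]
      exact hasDerivAt_const s 1
    simpa using h.unique hc
  have hn : HasDerivAt (nC γ)
      (((-(deriv (deriv γ) s).2 : ℝ) : ℂ) + Complex.I * ((deriv (deriv γ) s).1 : ℂ)) s :=
    h2.neg.ofReal_comp.add (h1.ofReal_comp.const_mul Complex.I)
  convert hn using 1
  have hu := hunit s
  simp only [nC, curv, nuVec]
  apply Complex.ext <;> simp
  · linear_combination (deriv (deriv γ) s).2 * hu - (deriv γ s).2 / 2 * horth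
  · linear_combination (deriv (deriv γ) s).1 * hu - (deriv γ s).1 / 2 * horth

theorem nC_mul_conj {γ : ℝ → ℝ × ℝ} {s : ℝ}
    (hunit : (deriv γ s).1 ^ 2 + (deriv γ s).2 ^ 2 = 1) :
    nC γ s * (starRingEnd ℂ) (nC γ s) = 1 := by
  simp only [nC, nuVec]
  apply Complex.ext <;> simp
  · linear_combination hunit
  · ring

theorem hasDerivAt_phi1 {f : ℝ → ℂ} {f' : ℂ} {s : ℝ} (hf : HasDerivAt f f' s) (t : ℝ) :
    HasDerivAt (fun x => phi1 (f x) t)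
      (0, (Real.cos (π * (t + 1) / 4) : ℂ) / 2 * (-(Complex.I * f')) +
        (Real.sin (π * (t + 1) / 4) : ℂ) / 2 * (Complex.I * f')) s :=
  (hasDerivAt_const s _).prodMk
    (((hf.const_mul Complex.I).neg.const_mul _).add ((hf.const_mul Complex.I).const_mul _))

theorem hasDerivAt_phi1m {f : ℝ → ℂ} {f' : ℂ} {s : ℝ} (hf : HasDerivAt f f' s) (t : ℝ) :
    HasDerivAt (fun x => phi1m (f x) t)
      ((starRingEnd ℂ) ((Real.cos (π * (t + 1) / 4) : ℂ) / 2 * (-(Complex.I * f')) +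
        (Real.sin (π * (t + 1) / 4) : ℂ) / 2 * (Complex.I * f')), 0) s :=
  (((hf.const_mul Complex.I).neg.const_mul _).add
    ((hf.const_mul Complex.I).const_mul _)).star.prodMk
      (hasDerivAt_const s ((starRingEnd ℂ) (phi1 0 t).1))

theorem sin_sub_cos_sq (t : ℝ) :
    (Real.sin (π * (t + 1) / 4) - Real.cos (π * (t + 1) / 4)) ^ 2
      = 1 - Real.sin (π / 2 * t + π / 2) := by
  have h : π / 2 * t + π / 2 = 2 * (π * (t + 1) / 4) := by ring
  rw [h, Real.sin_two_mul]
  linear_combination Real.sin_sq_add_cos_sq (π * (t + 1) / 4)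

theorem sin_sq_sub_cos_sq (t : ℝ) :
    Real.sin (π * (t + 1) / 4) ^ 2 - Real.cos (π * (t + 1) / 4) ^ 2
      = -Real.cos (π / 2 * t + π / 2) := by
  have h : π / 2 * t + π / 2 = 2 * (π * (t + 1) / 4) := by ring
  rw [h, Real.cos_two_mul']
  ring

theorem integral_sin_sub_cos_sq :
    ∫ t in (-1 : ℝ)..1, (Real.sin (π * (t + 1) / 4) - Real.cos (π * (t + 1) / 4)) ^ 2
      = 2 - 4 / π := by
  have hpi : π / 2 ≠ 0 := by positivity
  simp_rw [sin_sub_cos_sq]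
  rw [intervalIntegral.integral_sub (by simp)
    (Continuous.intervalIntegrable (by fun_prop) _ _),
    intervalIntegral.integral_comp_mul_add (fun x => Real.sin x) hpi, integral_sin]
  have h : π / 2 + π / 2 = π := by ring
  simp only [h, mul_neg, mul_one, neg_add_cancel, Real.cos_zero, Real.cos_pi,
    intervalIntegral.integral_const, smul_eq_mul]
  field_simp
  ring

theorem integral_sin_sq_sub_cos_sq :
    ∫ t in (-1 : ℝ)..1, (Real.sin (π * (t + 1) / 4) ^ 2 - Real.cos (π * (t + 1) / 4) ^ 2) = 0 := by
  have hpi : π / 2 ≠ 0 := by positivity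
  simp_rw [sin_sq_sub_cos_sq]
  rw [intervalIntegral.integral_neg,
    intervalIntegral.integral_comp_mul_add (fun x => Real.cos x) hpi, integral_cos]
  have h : π / 2 + π / 2 = π := by ring
  simp [h]

theorem integral_eq_of_eq_ofReal_mul {a b : ℝ} {F : ℝ → ℂ} {g : ℝ → ℝ} {c : ℂ}
    (h : ∀ t, F t = (g t : ℂ) * c) :
    ∫ t in a..b, F t = ((∫ t in a..b, g t : ℝ) : ℂ) * c := by
  simp_rw [h]
  rw [intervalIntegral.integral_mul_const, intervalIntegral.integral_ofReal]

theorem transverse_mode_pairings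
    (γ : ℝ → ℝ × ℝ) (hγ : ContDiff ℝ 2 γ)
    (hunit : ∀ s : ℝ, (deriv γ s).1 ^ 2 + (deriv γ s).2 ^ 2 = 1) :
    ∀ s : ℝ,
      (∫ t in (-1 : ℝ)..1, inner2 (phi1 (nC γ s) t) (deriv (fun s' => phi1 (nC γ s') t) s) =
          Complex.I * (curv γ s : ℂ) / 4 * ((4 / π - 2 : ℝ) : ℂ)) ∧
      (∫ t in (-1 : ℝ)..1, inner2 (phi1m (nC γ s) t) (deriv (fun s' => phi1m (nC γ s') t) s) =
          Complex.I * (curv γ s : ℂ) / 4 * ((2 - 4 / π : ℝ) : ℂ)) ∧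
      (∫ t in (-1 : ℝ)..1, inner2 (phi1 (nC γ s) t) (deriv (fun s' => phi1m (nC γ s') t) s) = 0) ∧
      (∫ t in (-1 : ℝ)..1, inner2 (phi1m (nC γ s) t) (deriv (fun s' => phi1 (nC γ s') t) s) = 0) := by
  intro s
  have hd := hasDerivAt_nC hγ hunit s
  have hn := nC_mul_conj (hunit s)
  have hI := Complex.I_sq
  refine ⟨?_, ?_, ?_, ?_⟩
  · rw [integral_eq_of_eq_ofReal_mul
      (g := fun t => (Real.sin (π * (t + 1) / 4) - Real.cos (π * (t + 1) / 4)) ^ 2)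
      (c := -(Complex.I * (curv γ s : ℂ) / 4)), integral_sin_sub_cos_sq]
    · push_cast
      ring
    · intro t
      rw [(hasDerivAt_phi1 hd t).deriv]
      simp only [inner2, phi1, map_add, map_mul, map_neg, map_div₀, Complex.conj_I,
        Complex.conj_ofReal, map_ofNat, map_zero]
      push_cast
      generalize Complex.sin _ = S
      generalize Complex.cos _ = C
      linear_combination (S - C) ^ 2 / 4 * Complex.I ^ 3 * (curv γ s : ℂ) * hn
        + (S - C) ^ 2 / 4 * Complex.I * (curv γ s : ℂ) * hI
  · rw [integral_eq_of_eq_ofReal_mul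
      (g := fun t => (Real.sin (π * (t + 1) / 4) - Real.cos (π * (t + 1) / 4)) ^ 2)
      (c := Complex.I * (curv γ s : ℂ) / 4), integral_sin_sub_cos_sq]
    · push_cast
      ring
    · intro t
      rw [(hasDerivAt_phi1m hd t).deriv]
      simp only [inner2, phi1m, phi1, map_add, map_mul, map_neg, map_div₀, Complex.conj_I,
        Complex.conj_ofReal, map_ofNat, map_zero, Complex.conj_conj]
      push_cast
      generalize Complex.sin _ = S
      generalize Complex.cos _ = C
      linear_combination -(S - C) ^ 2 / 4 * Complex.I ^ 3 * (curv γ s : ℂ) * hn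
        - (S - C) ^ 2 / 4 * Complex.I * (curv γ s : ℂ) * hI
  · rw [integral_eq_of_eq_ofReal_mul
      (g := fun t => Real.sin (π * (t + 1) / 4) ^ 2 - Real.cos (π * (t + 1) / 4) ^ 2)
      (c := Complex.I * (Complex.I * (curv γ s : ℂ) * nC γ s) / 4), integral_sin_sq_sub_cos_sq]
    · simp
    · intro t
      rw [(hasDerivAt_phi1m hd t).deriv]
      simp only [inner2, phi1, Complex.conj_conj, map_zero]
      push_cast
      ring
  · rw [integral_eq_of_eq_ofReal_mul
      (g := fun t => Real.sin (π * (t + 1) / 4) ^ 2 - Real.cos (π * (t + 1) / 4) ^ 2)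
      (c := (starRingEnd ℂ) (Complex.I * (Complex.I * (curv γ s : ℂ) * nC γ s)) / 4),
      integral_sin_sq_sub_cos_sq]
    · simp
    · intro t
      rw [(hasDerivAt_phi1 hd t).deriv]
      simp only [inner2, phi1m, phi1, map_add, map_mul, map_neg, map_div₀, Complex.conj_I,
        Complex.conj_ofReal, map_ofNat, map_zero]
      push_cast
      ring
end
end
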